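/- Suppose f xᵢ ≥ 0, and suppose x̄ ∈ X is a global minimizer of Q (i.e., Q(x̄) ≤ Q(x) for all x ∈ X) with f x̄ ≥ 0. Then no cost-effective evasion exists and xᵢ is a global minimizer of Φ: Φ(xᵢ) = 0 and Φ(x) ≥ 0 for all x ∈ X. -/

import Mathlib

/-- if `f xᵢ ≥ 0` and a global minimizer `x̄` of `Q` still has `f x̄ ≥ 0`,
then no cost-effective evasion exists and `xᵢ` globally minimizes `Φ`:
`Φ xᵢ = 0` and `Φ x ≥ 0` for all `x`. -/
theorem no_cost_effective_evasion
    {X : Type*} (f c : X → ℝ) (xi : X)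
    (hc : ∀ x, 0 ≤ c x) (hcxi : c xi = 0)
    (Φ Q : X → ℝ)
    (hΦ : ∀ x, Φ x = min 0 (f x) + c x)
    (hQ : ∀ x, Q x = f x + c x)
    (hfxi : 0 ≤ f xi)
    (xbar : X) (hbar : ∀ x, Q xbar ≤ Q x) (hfbar : 0 ≤ f xbar) :
    Φ xi = 0 ∧ ∀ x, 0 ≤ Φ x := by
  refine ⟨by rw [hΦ, hcxi, min_eq_left hfxi, add_zero], fun x => ?_⟩
  have hQx : 0 ≤ f x + c x := by
    rw [← hQ]
    exact ((hQ xbar).symm ▸ add_nonneg hfbar (hc xbar)).trans (hbar x)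
  rw [hΦ, min_add, zero_add]
  exact le_min (hc x) hQx
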